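/- If heaps H and H' over P are homeomorphic, then for all pointer variables p, p' ∈ P: pathLength(H, L p, L p') = pathLength(H', L' p, L' p'), and circular(H, L p) holds if and only if circular(H', L' p) holds. -/

import Mathlib

/-- A heap over pointer variables `P`: a finite set `V` of vertices (drawn from `ℕ`),
a partial successor function `succ` (with `succ v = none` outside `V`),
an edge-weight function `wt` (weights are at least 1 on actual edges),
and a labelling `L` of pointer variables by vertices. -/
structure Heap (P : Type) where
  V : Finset ℕ
  succ : ℕ → Option ℕ
  wt : ℕ → ℕ
  L : P → ℕ
  label_mem : ∀ p, L p ∈ V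
  succ_mem : ∀ v ∈ V, ∀ u, succ v = some u → u ∈ V
  succ_dom : ∀ v, v ∉ V → succ v = none
  wt_pos : ∀ v ∈ V, succ v ≠ none → 1 ≤ wt v

namespace Heap

variable {P : Type}

/-- `vs` is a walk from `x` to `y`: a nonempty list of vertices starting at `x`,
ending at `y`, where each vertex's successor is the next list element. -/
def IsWalk (H : Heap P) (x y : ℕ) (vs : List ℕ) : Prop :=
  vs.head? = some x ∧ vs.getLast? = some y ∧
    List.Chain' (fun a b => H.succ a = some b) vs

/-- The weight of a walk: the sum of the weights of its edges,
i.e. of `wt vᵢ` over all but the last vertex. -/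
def walkWeight (H : Heap P) (vs : List ℕ) : ℕ :=
  (vs.dropLast.map H.wt).sum

/-- `pathLength H x y ∈ ℕ ∪ {∞}`: the least weight of a walk from `x` to `y`,
and `∞` if there is no walk. -/
noncomputable def pathLength (H : Heap P) (x y : ℕ) : ℕ∞ :=
  sInf {n : ℕ∞ | ∃ vs : List ℕ, H.IsWalk x y vs ∧ n = (H.walkWeight vs : ℕ∞)}

/-- `x` lies on a cycle: there is a walk from `x` to `x` with at least one step. -/
def Circular (H : Heap P) (x : ℕ) : Prop :=
  ∃ vs : List ℕ, H.IsWalk x x vs ∧ 2 ≤ vs.length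

/-- A vertex is reachable if some labelled vertex reaches it by following successors. -/
def Reachable (H : Heap P) (v : ℕ) : Prop :=
  ∃ p : P, Relation.ReflTransGen (fun a b => H.succ a = some b) (H.L p) v

/-- `H'` is obtained from `H` by a single-edge subdivision: the edge from `u`
(with `succ u = some v` and weight `n ≥ 2`) is split, for some `1 ≤ k < n`, by a
fresh vertex `q` into an edge `u → q` of weight `k` and an edge `q → v` of weight
`n - k`; everything else is unchanged. -/
def SingleSubdiv (H H' : Heap P) : Prop :=
  ∃ u v q k : ℕ,
    u ∈ H.V ∧ H.succ u = some v ∧ 2 ≤ H.wt u ∧ 1 ≤ k ∧ k < H.wt u ∧ q ∉ H.V ∧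
    H'.V = insert q H.V ∧
    H'.succ = Function.update (Function.update H.succ u (some q)) q (some v) ∧
    H'.wt = Function.update (Function.update H.wt u k) q (H.wt u - k) ∧
    H'.L = H.L

/-- `H'` is a subdivision of `H`: it is obtained from `H` by a finite (possibly
empty) sequence of single-edge subdivisions. -/
def Subdiv (H H' : Heap P) : Prop :=
  Relation.ReflTransGen SingleSubdiv H H'

/-- Heap isomorphism: a bijection between the reachable vertices that respects
labels, successors and weights. -/
def Iso (H H' : Heap P) : Prop :=
  ∃ f : ℕ → ℕ,
    Set.BijOn f {v | H.Reachable v} {v | H'.Reachable v} ∧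
    (∀ p, f (H.L p) = H'.L p) ∧
    (∀ v, H.Reachable v → H'.succ (f v) = Option.map f (H.succ v)) ∧
    (∀ v, H.Reachable v → H.succ v ≠ none → H'.wt (f v) = H.wt v)

/-- Heap homeomorphism: some subdivision of `H` is isomorphic to some
subdivision of `H'`. -/
def Homeo (H H' : Heap P) : Prop :=
  ∃ S S' : Heap P, H.Subdiv S ∧ H'.Subdiv S' ∧ Iso S S'

end Heap

namespace Heap

variable {P : Type}

/-- `H.WalkOfWeight x y n`: there is a walk from `x` to `y` of weight `n`. -/
inductive WalkOfWeight (H : Heap P) : ℕ → ℕ → ℕ → Prop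
  | refl (x : ℕ) : WalkOfWeight H x x 0
  | step {x z y n : ℕ} : H.succ x = some z → WalkOfWeight H z y n →
      WalkOfWeight H x y (H.wt x + n)

lemma mem_of_succ_eq_some (H : Heap P) {x z : ℕ} (h : H.succ x = some z) : x ∈ H.V := by
  by_contra hx
  simp [H.succ_dom x hx] at h

lemma one_le_wt_of_succ_eq_some (H : Heap P) {x z : ℕ} (h : H.succ x = some z) :
    1 ≤ H.wt x :=
  H.wt_pos x (H.mem_of_succ_eq_some h) (by simp [h])

lemma isWalk_singleton_iff (H : Heap P) {x y a : ℕ} :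
    H.IsWalk x y [a] ↔ a = x ∧ a = y := by
  simp [IsWalk, List.Chain']

lemma isWalk_cons_cons_iff (H : Heap P) {x y a b : ℕ} {vs : List ℕ} :
    H.IsWalk x y (a :: b :: vs) ↔ a = x ∧ H.succ a = some b ∧ H.IsWalk b y (b :: vs) := by
  simp only [IsWalk, List.Chain', List.head?_cons, Option.some.injEq, List.getLast?_cons_cons,
    List.isChain_cons_cons, true_and]
  tauto

lemma IsWalk.walkOfWeight {H : Heap P} {y : ℕ} :
    ∀ {vs : List ℕ} {x : ℕ}, H.IsWalk x y vs → H.WalkOfWeight x y (H.walkWeight vs)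
  | [], x, h => by simp [IsWalk] at h
  | [a], x, h => by
    obtain ⟨rfl, rfl⟩ := H.isWalk_singleton_iff.1 h
    exact .refl a
  | a :: b :: vs, x, h => by
    obtain ⟨rfl, hs, hw⟩ := H.isWalk_cons_cons_iff.1 h
    simpa [walkWeight] using WalkOfWeight.step hs hw.walkOfWeight

lemma WalkOfWeight.exists_isWalk {H : Heap P} {x y n : ℕ} (h : H.WalkOfWeight x y n) :
    ∃ vs, H.IsWalk x y vs ∧ n = H.walkWeight vs := by
  induction h with
  | refl x => exact ⟨[x], by simp [isWalk_singleton_iff], by simp [walkWeight]⟩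
  | @step x z y n hs _ ih =>
    obtain ⟨vs, hw, rfl⟩ := ih
    match vs, hw with
    | [], hw => simp [IsWalk] at hw
    | b :: vs, hw =>
      obtain rfl : b = z := by simpa using hw.1
      exact ⟨x :: b :: vs, H.isWalk_cons_cons_iff.2 ⟨rfl, hs, hw⟩, by simp [walkWeight]⟩

lemma pathLength_eq_sInf_walkOfWeight (H : Heap P) (x y : ℕ) :
    H.pathLength x y = sInf {n : ℕ∞ | ∃ m : ℕ, H.WalkOfWeight x y m ∧ n = m} := by
  unfold pathLength
  congr 1
  ext n
  constructor
  · rintro ⟨vs, hw, rfl⟩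
    exact ⟨_, hw.walkOfWeight, rfl⟩
  · rintro ⟨m, hm, rfl⟩
    obtain ⟨vs, hw, rfl⟩ := hm.exists_isWalk
    exact ⟨vs, hw, rfl⟩

lemma circular_iff_walkOfWeight (H : Heap P) (x : ℕ) :
    H.Circular x ↔ ∃ n, 1 ≤ n ∧ H.WalkOfWeight x x n := by
  constructor
  · rintro ⟨vs, hw, hl⟩
    refine ⟨_, ?_, hw.walkOfWeight⟩
    match vs, hw, hl with
    | a :: b :: vs, hw, _ =>
      have := H.one_le_wt_of_succ_eq_some (H.isWalk_cons_cons_iff.1 hw).2.1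
      simp [walkWeight]
      omega
  · rintro ⟨n, hn, h⟩
    obtain ⟨vs, hw, rfl⟩ := h.exists_isWalk
    refine ⟨vs, hw, ?_⟩
    match vs, hn with
    | [], hn => simp [walkWeight] at hn
    | [a], hn => simp [walkWeight] at hn
    | a :: b :: vs, _ => simp

lemma SingleSubdiv.walkOfWeight_iff {H H' : Heap P} (h : H.SingleSubdiv H') {x y n : ℕ}
    (hx : x ∈ H.V) (hy : y ∈ H.V) : H.WalkOfWeight x y n ↔ H'.WalkOfWeight x y n := by
  obtain ⟨u, v, q, k, hu, huv, -, -, hk, hq, -, hsucc, hwt, -⟩ := h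
  have huq : u ≠ q := by rintro rfl; exact hq hu
  have succ_u : H'.succ u = some q := by simp [hsucc, huq]
  have succ_q : H'.succ q = some v := by simp [hsucc]
  have wt_u : H'.wt u = k := by simp [hwt, huq]
  have wt_q : H'.wt q = H.wt u - k := by simp [hwt]
  have succ_other : ∀ a, a ≠ u → a ≠ q → H'.succ a = H.succ a := by
    intro a hau haq; simp [hsucc, hau, haq]
  have wt_other : ∀ a, a ≠ u → a ≠ q → H'.wt a = H.wt a := by
    intro a hau haq; simp [hwt, hau, haq]
  constructor
  · intro hw
    clear hx hy
    induction hw with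
    | refl x => exact .refl x
    | @step x z y n hs _ ih =>
      have haq : x ≠ q := by rintro rfl; exact hq (H.mem_of_succ_eq_some hs)
      by_cases hxu : x = u
      · subst hxu
        obtain rfl : v = z := by simpa [huv] using hs
        have := WalkOfWeight.step succ_u (WalkOfWeight.step succ_q ih)
        rwa [wt_u, wt_q, ← add_assoc, Nat.add_sub_cancel' hk.le] at this
      · rw [← wt_other x hxu haq]
        exact .step (by rw [succ_other x hxu haq, hs]) ih
  · intro hw
    have key : (x ∈ H.V → H.WalkOfWeight x y n) ∧
        (x = q → ∃ m, n = H.wt u - k + m ∧ H.WalkOfWeight v y m) := by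
      clear hx
      induction hw with
      | refl x => exact ⟨fun _ => .refl x, by rintro rfl; exact absurd hy hq⟩
      | @step x z y n hs _ ih =>
        obtain ⟨ih_mem, ih_q⟩ := ih hy
        constructor
        · intro hx
          have hxq : x ≠ q := by rintro rfl; exact hq hx
          by_cases hxu : x = u
          · subst hxu
            obtain ⟨m, rfl, hm⟩ := ih_q (by simpa [succ_u] using hs.symm)
            rw [wt_u, ← add_assoc, Nat.add_sub_cancel' hk.le]
            exact .step huv hm
          · rw [succ_other x hxu hxq] at hs
            rw [wt_other x hxu hxq]
            exact .step hs (ih_mem (H.succ_mem x hx z hs))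
        · rintro rfl
          obtain rfl : v = z := by simpa [succ_q] using hs
          exact ⟨n, by rw [wt_q], ih_mem (H.succ_mem u hu v huv)⟩
    exact key.1 hx

lemma SingleSubdiv.label_eq {H H' : Heap P} (h : H.SingleSubdiv H') : H'.L = H.L := by
  obtain ⟨_, _, _, _, -, -, -, -, -, -, -, -, -, hL⟩ := h
  exact hL

lemma Subdiv.walkOfWeight_label_iff {H S : Heap P} (h : H.Subdiv S) (p p' : P) (n : ℕ) :
    H.WalkOfWeight (H.L p) (H.L p') n ↔ S.WalkOfWeight (S.L p) (S.L p') n := by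
  induction h with
  | refl => rfl
  | @tail T S _ hTS ih =>
    rw [ih, hTS.label_eq, hTS.walkOfWeight_iff (T.label_mem p) (T.label_mem p')]

lemma reachable_label (H : Heap P) (p : P) : H.Reachable (H.L p) := ⟨p, .refl⟩

lemma Reachable.succ {H : Heap P} {x z : ℕ} (hx : H.Reachable x) (h : H.succ x = some z) :
    H.Reachable z :=
  hx.imp fun _ hp => hp.tail h

lemma Iso.walkOfWeight_label_iff {H H' : Heap P} (h : Iso H H') (p p' : P) (n : ℕ) :
    H.WalkOfWeight (H.L p) (H.L p') n ↔ H'.WalkOfWeight (H'.L p) (H'.L p') n := by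
  obtain ⟨f, hbij, hL, hsucc, hwt⟩ := h
  constructor
  · have map_walk : ∀ {x y n}, H.WalkOfWeight x y n → H.Reachable x →
        H'.WalkOfWeight (f x) (f y) n := by
      intro x y n hw
      induction hw with
      | refl x => exact fun _ => .refl _
      | @step x z y n hs _ ih =>
        intro hx
        rw [← hwt x hx (by simp [hs])]
        exact .step (by rw [hsucc x hx, hs]; rfl) (ih (hx.succ hs))
    intro hw
    simpa only [hL] using map_walk hw (H.reachable_label p)
  · have lift_walk : ∀ {x' y' n}, H'.WalkOfWeight x' y' n → ∀ x, H.Reachable x → f x = x' →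
        ∃ y, H.Reachable y ∧ f y = y' ∧ H.WalkOfWeight x y n := by
      intro x' y' n hw
      induction hw with
      | refl x' => exact fun x hx hfx => ⟨x, hx, hfx, .refl x⟩
      | @step x' z' y' n hs _ ih =>
        rintro x hx rfl
        rw [hsucc x hx, Option.map_eq_some_iff] at hs
        obtain ⟨z, hz, hfz⟩ := hs
        obtain ⟨y, hy, hfy, hw⟩ := ih z (hx.succ hz) hfz
        rw [hwt x hx (by simp [hz])]
        exact ⟨y, hy, hfy, .step hz hw⟩
    intro hw
    obtain ⟨y, hy, hfy, hw⟩ := lift_walk hw _ (H.reachable_label p) (hL p)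
    rwa [hbij.injOn hy (H.reachable_label p') (hfy.trans (hL p').symm)] at hw

lemma Homeo.walkOfWeight_label_iff {H H' : Heap P} (h : H.Homeo H') (p p' : P) (n : ℕ) :
    H.WalkOfWeight (H.L p) (H.L p') n ↔ H'.WalkOfWeight (H'.L p) (H'.L p') n := by
  obtain ⟨S, S', hS, hS', hiso⟩ := h
  rw [hS.walkOfWeight_label_iff, hiso.walkOfWeight_label_iff, hS'.walkOfWeight_label_iff]

end Heap

/-- Observation-preservation part of the paper's Theorem "Homeomorphism is a
sound equivalence relation": homeomorphic heaps satisfy the same `pathLength`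
and `circular` observations on labelled vertices. -/
theorem homeo_preserves_observations {P : Type} (H H' : Heap P)
    (h : H.Homeo H') :
    (∀ p p' : P, H.pathLength (H.L p) (H.L p') = H'.pathLength (H'.L p) (H'.L p')) ∧
    (∀ p : P, (H.Circular (H.L p) ↔ H'.Circular (H'.L p))) := by
  simp only [Heap.pathLength_eq_sInf_walkOfWeight, Heap.circular_iff_walkOfWeight,
    h.walkOfWeight_label_iff, implies_true, and_self]
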